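/- Let N ≥ 2 be an integer, p_c = 1/N, p_d ∈ (p_c, 1], q̃_c = (1-p_c)^N, q̃_d = (1-p_d)·(1-p_c)^(N-1), q_c = p_c·(1-p_c)^(N-1), and suppose B ∈ (0, q̃_c − q̃_d). With P̃_f(B,L) = F(L·(q̃_c−B); L, q̃_c) and P̃_m(B,L;p_d) = 1 − F(L·(q̃_c−B); L, q̃_d), where F(y;n,p) = Σ_{m=0}^{⌊y⌋} C(n,m)·p^m·(1-p)^(n-m), define for L, M ≥ 1: Ũ_rr = L·q_c/(L + P̃_f(B,L)·M), Ũ_dr = L·p_d·(1-p_c)^(N-1)/(L + (1−P̃_m(B,L;p_d))·M), and C̃ = N·P̃_f(B,L)·M·q_c/(L + P̃_f(B,L)·M). Then for every δ > 0 there exist natural numbers L, M ≥ 1 such that Ũ_rr ≥ Ũ_dr and C̃ ≤ δ. -/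

import Mathlib

/-- Binomial cumulative distribution function `F(y; n, p) = ∑_{m=0}^{⌊y⌋} C(n,m) p^m (1-p)^(n-m)`. -/
noncomputable def binCDF (y : ℝ) (n : ℕ) (p : ℝ) : ℝ :=
  ∑ m ∈ Finset.range (n + 1),
    if (m : ℝ) ≤ y then (n.choose m : ℝ) * p ^ m * (1 - p) ^ (n - m) else 0


lemma bin_sum (n : ℕ) (p : ℝ) :
    ∑ m ∈ Finset.range (n + 1), (n.choose m : ℝ) * p ^ m * (1 - p) ^ (n - m) = 1 := by
  have h := congrArg (Polynomial.eval p) (bernsteinPolynomial.sum ℝ n)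
  simpa [Polynomial.eval_finset_sum, bernsteinPolynomial] using h

lemma bin_var (n : ℕ) (p : ℝ) :
    ∑ m ∈ Finset.range (n + 1),
      ((n : ℝ) * p - m) ^ 2 * ((n.choose m : ℝ) * p ^ m * (1 - p) ^ (n - m))
      = n * p * (1 - p) := by
  have h := congrArg (Polynomial.eval p) (bernsteinPolynomial.variance ℝ n)
  simpa [Polynomial.eval_finset_sum, bernsteinPolynomial] using h

lemma bin_w_nonneg (n m : ℕ) (p : ℝ) (h0 : 0 ≤ p) (h1 : p ≤ 1) :
    0 ≤ (n.choose m : ℝ) * p ^ m * (1 - p) ^ (n - m) := by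
  have : 0 ≤ 1 - p := by linarith
  positivity

lemma binCDF_nonneg (y : ℝ) (n : ℕ) (p : ℝ) (h0 : 0 ≤ p) (h1 : p ≤ 1) :
    0 ≤ binCDF y n p := by
  unfold binCDF
  refine Finset.sum_nonneg fun m _ => ?_
  split_ifs
  · exact bin_w_nonneg n m p h0 h1
  · exact le_rfl

lemma binCDF_le_one (y : ℝ) (n : ℕ) (p : ℝ) (h0 : 0 ≤ p) (h1 : p ≤ 1) :
    binCDF y n p ≤ 1 := by
  rw [← bin_sum n p]
  unfold binCDF
  refine Finset.sum_le_sum fun m _ => ?_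
  split_ifs
  · exact le_rfl
  · exact bin_w_nonneg n m p h0 h1

lemma var_le (n : ℕ) (p : ℝ) : (n : ℝ) * p * (1 - p) ≤ n := by
  have : p * (1 - p) ≤ 1 := by nlinarith [sq_nonneg (p - 1 / 2)]
  have hn : (0 : ℝ) ≤ n := Nat.cast_nonneg n
  nlinarith

lemma bin_lower (n : ℕ) (p t : ℝ) (h0 : 0 ≤ p) (h1 : p ≤ 1) (ht : 0 < t) :
    ((n : ℝ) * t) ^ 2 * binCDF (n * (p - t)) n p ≤ n := by
  refine le_trans ?_ (var_le n p)
  rw [← bin_var n p]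
  unfold binCDF
  rw [Finset.mul_sum]
  refine Finset.sum_le_sum fun m _ => ?_
  have hw := bin_w_nonneg n m p h0 h1
  split_ifs with h
  · refine mul_le_mul_of_nonneg_right ?_ hw
    refine pow_le_pow_left₀ (by positivity) ?_ 2
    linarith
  · rw [mul_zero]; positivity

lemma bin_upper (n : ℕ) (p t : ℝ) (h0 : 0 ≤ p) (h1 : p ≤ 1) (ht : 0 < t) :
    ((n : ℝ) * t) ^ 2 * (1 - binCDF (n * (p + t)) n p) ≤ n := by
  refine le_trans ?_ (var_le n p)
  rw [← bin_var n p]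
  unfold binCDF
  nth_rewrite 1 [← bin_sum n p]
  rw [← Finset.sum_sub_distrib, Finset.mul_sum]
  refine Finset.sum_le_sum fun m _ => ?_
  have hw := bin_w_nonneg n m p h0 h1
  split_ifs with h
  · rw [sub_self, mul_zero]; positivity
  · rw [sub_zero]
    refine mul_le_mul_of_nonneg_right ?_ hw
    rw [← neg_sq ((n : ℝ) * p - m)]
    refine pow_le_pow_left₀ (by positivity) ?_ 2
    linarith

open Filter Topology in
lemma tendsto_zero_of_cheb (f : ℕ → ℝ) (t : ℝ) (ht : 0 < t) (h0 : ∀ n, 0 ≤ f n)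
    (h : ∀ n : ℕ, ((n : ℝ) * t) ^ 2 * f n ≤ n) : Tendsto f atTop (𝓝 0) := by
  have hlim : Tendsto (fun n : ℕ => (1 / t ^ 2) / (n : ℝ)) atTop (𝓝 0) :=
    tendsto_const_div_atTop_nhds_zero_nat _
  refine tendsto_of_tendsto_of_tendsto_of_le_of_le' tendsto_const_nhds hlim
    (Eventually.of_forall h0) ?_
  filter_upwards [eventually_gt_atTop 0] with n hn
  have hn' : (0 : ℝ) < n := by exact_mod_cast hn
  rw [div_div, le_div_iff₀ (by positivity)]
  have := h n
  have h2 : (n : ℝ) * (f n * (t ^ 2 * n)) ≤ n * 1 := by nlinarith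
  exact le_of_mul_le_mul_left h2 hn'

open Filter Topology

/-- With a margin of error `B ∈ (0, q̃_c - q̃_d)`, for every `δ > 0` there are
lengths `L, M` such that the review protocol based on the idle slot ratio test is
deviation-proof against the constant deviation `pd` and `δ`-Pareto optimal. -/
theorem stmt13 (N : ℕ) (hN : 2 ≤ N) (pd : ℝ)
    (hpd1 : 1 / (N : ℝ) < pd) (hpd2 : pd ≤ 1)
    (pc qtc qtd qc : ℝ) (hpc : pc = 1 / N)
    (hqtc : qtc = (1 - pc) ^ N)
    (hqtd : qtd = (1 - pd) * (1 - pc) ^ (N - 1))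
    (hqc : qc = pc * (1 - pc) ^ (N - 1))
    (B : ℝ) (hB : B ∈ Set.Ioo (0 : ℝ) (qtc - qtd))
    (Pf Pm : ℕ → ℝ)
    (hPf : ∀ L, Pf L = binCDF ((L : ℝ) * (qtc - B)) L qtc)
    (hPm : ∀ L, Pm L = 1 - binCDF ((L : ℝ) * (qtc - B)) L qtd)
    (Urr Udr C : ℕ → ℕ → ℝ)
    (hUrr : ∀ L M, Urr L M = (L : ℝ) * qc / ((L : ℝ) + Pf L * M))
    (hUdr : ∀ L M, Udr L M =
      (L : ℝ) * pd * (1 - pc) ^ (N - 1) / ((L : ℝ) + (1 - Pm L) * M))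
    (hC : ∀ L M, C L M = N * Pf L * M * qc / ((L : ℝ) + Pf L * M)) :
    ∀ δ : ℝ, 0 < δ →
      ∃ L M : ℕ, 1 ≤ L ∧ 1 ≤ M ∧ Urr L M ≥ Udr L M ∧ C L M ≤ δ := by
  intro δ hδ
  obtain ⟨hB0, hB1⟩ := hB
  have hN' : (2 : ℝ) ≤ N := by exact_mod_cast hN
  have hpc0 : 0 < pc := by rw [hpc]; positivity
  have hpc1 : pc < 1 := by
    rw [hpc, div_lt_one (by linarith)]; linarith
  rw [← hpc] at hpd1
  have hr0 : 0 < (1 - pc) ^ (N - 1) := pow_pos (by linarith) _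
  have hr1 : (1 - pc) ^ (N - 1) ≤ 1 := pow_le_one₀ (by linarith) (by linarith)
  have hqtc0 : 0 ≤ qtc := by rw [hqtc]; exact pow_nonneg (by linarith) _
  have hqtc1 : qtc ≤ 1 := by rw [hqtc]; exact pow_le_one₀ (by linarith) (by linarith)
  have hqtd0 : 0 ≤ qtd := by rw [hqtd]; exact mul_nonneg (by linarith) hr0.le
  have hqtd1 : qtd ≤ 1 := by linarith
  have hqc0 : 0 < qc := by rw [hqc]; positivity
  have hPf0 : ∀ L, 0 ≤ Pf L := fun L => by
    rw [hPf]; exact binCDF_nonneg _ _ _ hqtc0 hqtc1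
  have hPm0 : ∀ L, 0 ≤ Pm L := fun L => by
    rw [hPm]; linarith [binCDF_le_one ((L : ℝ) * (qtc - B)) L qtd hqtd0 hqtd1]
  have hPm1 : ∀ L, Pm L ≤ 1 := fun L => by
    rw [hPm]; linarith [binCDF_nonneg ((L : ℝ) * (qtc - B)) L qtd hqtd0 hqtd1]
  have hPft : Tendsto Pf atTop (𝓝 0) := by
    refine tendsto_zero_of_cheb Pf B hB0 hPf0 fun n => ?_
    rw [hPf]; exact bin_lower n qtc B hqtc0 hqtc1 hB0
  have hPmt : Tendsto Pm atTop (𝓝 0) := by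
    have ht : 0 < qtc - B - qtd := by linarith
    refine tendsto_zero_of_cheb Pm _ ht hPm0 fun n => ?_
    have := bin_upper n qtd _ hqtd0 hqtd1 ht
    rw [hPm]
    rwa [show qtd + (qtc - B - qtd) = qtc - B by ring] at this
  set a := pd * (1 - pc) ^ (N - 1) with ha
  obtain ⟨K, hK⟩ := exists_nat_gt (a / qc)
  have ha0 : 0 < a := mul_pos (by linarith) hr0
  have hK0 : (0 : ℝ) < K := lt_trans (by positivity) hK
  rw [div_lt_iff₀ hqc0] at hK
  have e1 : ∀ᶠ L in atTop, a * (1 + Pf L * K) < qc * (1 + (1 - Pm L) * K) := by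
    have l1 : Tendsto (fun L => a * (1 + Pf L * K)) atTop (𝓝 (a * (1 + 0 * K))) :=
      ((hPft.mul_const _).const_add _).const_mul _
    have l2 : Tendsto (fun L => qc * (1 + (1 - Pm L) * K)) atTop
        (𝓝 (qc * (1 + (1 - 0) * K))) :=
      (((hPmt.const_sub _).mul_const _).const_add _).const_mul _
    exact l1.eventually_lt l2 (by nlinarith)
  have e2 : ∀ᶠ L in atTop, N * Pf L * K * qc < δ := by
    have l1 : Tendsto (fun L => N * Pf L * K * qc) atTop (𝓝 (N * 0 * K * qc)) :=
      ((hPft.const_mul _).mul_const _).mul_const _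
    exact l1.eventually_lt_const (by simpa using hδ)
  obtain ⟨L, h1, h2, hL⟩ := (e1.and (e2.and (eventually_ge_atTop 1))).exists
  have hKn : 1 ≤ K := by exact_mod_cast hK0
  have hL0 : (0 : ℝ) < L := by exact_mod_cast hL
  have hf := hPf0 L
  have hm : 0 ≤ 1 - Pm L := by linarith [hPm1 L]
  have hd1 : (L : ℝ) + Pf L * ((L * K : ℕ) : ℝ) = L * (1 + Pf L * K) := by push_cast; ring
  have hd2 : (L : ℝ) + (1 - Pm L) * ((L * K : ℕ) : ℝ) = L * (1 + (1 - Pm L) * K) := by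
    push_cast; ring
  have p1 : 0 < 1 + Pf L * K := by positivity
  have p2 : 0 < 1 + (1 - Pm L) * K := by positivity
  refine ⟨L, L * K, hL, Nat.mul_pos hL hKn, ?_, ?_⟩
  · rw [hUrr, hUdr, hd1, hd2, mul_assoc, ← ha, mul_div_mul_left _ _ hL0.ne',
      mul_div_mul_left _ _ hL0.ne', ge_iff_le, div_le_div_iff₀ p2 p1]
    exact h1.le
  · rw [hC, hd1]
    have : (N : ℝ) * Pf L * ((L * K : ℕ) : ℝ) * qc = L * (N * Pf L * K * qc) := by
      push_cast; ring
    rw [this, mul_div_mul_left _ _ hL0.ne', div_le_iff₀ p1]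
    have : 0 ≤ Pf L * K := by positivity
    nlinarith
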